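/- arXiv:2206.11513 — 9 statements merged into one kernel-verified Lean document; each statement's English description precedes it below -/
import Mathlib

section
/- Let a ∈ A, ε > 0 and r ∈ ℝ with r ≠ 0. Then Λ_ε^S(r • a) = r · Λ_{ε/r²}^S(a), i.e. for every q ∈ ℍ one has q ∈ Λ_ε^S(r • a) if and only if r⁻¹ q ∈ Λ_{ε/r²}^S(a); equivalently Λ_ε^S(r • a) is the image of Λ_{ε/r²}^S(a) under the map q ↦ r q on ℍ. -/
noncomputable section

/-- `Q_q(a) = a² − 2 (Re q) • a + |q|² • 1`. -/
def Qop {A : Type*} [NormedRing A] [NormedAlgebra ℝ A] (a : A) (q : Quaternion ℝ) : A :=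
  a ^ 2 - (2 * q.re) • a + (‖q‖ ^ 2) • (1 : A)

/-- The S-spectrum `σ_S(a)`. -/
def sSpectrum {A : Type*} [NormedRing A] [NormedAlgebra ℝ A] (a : A) : Set (Quaternion ℝ) :=
  {q | ¬ IsUnit (Qop a q)}

/-- The ε-pseudo S-spectrum `Λ_ε^S(a)`. -/
def pseudoSSpectrum {A : Type*} [NormedRing A] [NormedAlgebra ℝ A] (ε : ℝ) (a : A) :
    Set (Quaternion ℝ) :=
  sSpectrum a ∪ {q | IsUnit (Qop a q) ∧ 1 / ε ≤ ‖Ring.inverse (Qop a q)‖}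

theorem Qop_smul_coe_mul {A : Type*} [NormedRing A] [NormedAlgebra ℝ A] (a : A) (r : ℝ)
    (q : Quaternion ℝ) : Qop (r • a) ((r : Quaternion ℝ) * q) = r ^ 2 • Qop a q := by
  simp only [Qop, smul_add, smul_sub, smul_smul, smul_pow, norm_smul,
    Quaternion.coe_mul_eq_smul, Quaternion.re_smul, smul_eq_mul, mul_pow, Real.norm_eq_abs, sq_abs]
  congr 3
  ring

theorem isUnit_smul_iff_of_ne_zero {A : Type*} [Ring A] [Algebra ℝ A] {c : ℝ} (hc : c ≠ 0)
    (x : A) : IsUnit (c • x) ↔ IsUnit x :=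
  isUnit_smul_iff (Units.mk0 c hc) x

theorem inverse_smul_of_ne_zero {A : Type*} [Ring A] [Algebra ℝ A] {c : ℝ} (hc : c ≠ 0)
    (x : A) : Ring.inverse (c • x) = c⁻¹ • Ring.inverse x := by
  have h : IsUnit (algebraMap ℝ A c) := (IsUnit.mk0 c hc).map _
  have hinv : Ring.inverse (algebraMap ℝ A c) = algebraMap ℝ A c⁻¹ := by
    rw [← mul_one (Ring.inverse _), Ring.inverse_mul_eq_iff_eq_mul _ _ _ h, ← map_mul,
      mul_inv_cancel₀ hc, map_one]
  rw [Algebra.smul_def, Ring.inverse_mul (.inl h), hinv, Algebra.smul_def, Algebra.commutes]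

theorem coe_mul_mem_pseudoSSpectrum_smul_iff {A : Type*} [NormedRing A] [NormedAlgebra ℝ A]
    (a : A) (ε : ℝ) {r : ℝ} (hr : r ≠ 0) (q : Quaternion ℝ) :
    (r : Quaternion ℝ) * q ∈ pseudoSSpectrum ε (r • a) ↔ q ∈ pseudoSSpectrum (ε / r ^ 2) a := by
  have hr2 : 0 < r ^ 2 := by positivity
  simp only [pseudoSSpectrum, sSpectrum, Set.mem_union, Set.mem_ofPred_eq, Qop_smul_coe_mul,
    isUnit_smul_iff_of_ne_zero hr2.ne', inverse_smul_of_ne_zero hr2.ne', norm_smul, norm_inv,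
    Real.norm_of_nonneg hr2.le, le_inv_mul_iff₀ hr2, one_div_div, mul_one_div]

theorem pseudoSSpectrum_real_smul
    {A : Type*} [NormedRing A] [NormedAlgebra ℝ A] [CompleteSpace A] [NormOneClass A]
    (a : A) (ε r : ℝ) (hε : 0 < ε) (hr : r ≠ 0) :
    (∀ q : Quaternion ℝ,
      q ∈ pseudoSSpectrum ε (r • a) ↔ (r : Quaternion ℝ)⁻¹ * q ∈ pseudoSSpectrum (ε / r ^ 2) a) ∧
    pseudoSSpectrum ε (r • a) =
      (fun q : Quaternion ℝ => (r : Quaternion ℝ) * q) '' pseudoSSpectrum (ε / r ^ 2) a := by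
  have hr' : (r : Quaternion ℝ) ≠ 0 := by
    rwa [← Quaternion.coe_zero, Ne, Quaternion.coe_inj]
  have key (q : Quaternion ℝ) : q ∈ pseudoSSpectrum ε (r • a) ↔
      (r : Quaternion ℝ)⁻¹ * q ∈ pseudoSSpectrum (ε / r ^ 2) a := by
    rw [← coe_mul_mem_pseudoSSpectrum_smul_iff a ε hr, mul_inv_cancel_left₀ hr']
  refine ⟨key, Set.ext fun q => ⟨fun hq => ⟨_, (key q).1 hq, mul_inv_cancel_left₀ hr' q⟩, ?_⟩⟩
  rintro ⟨p, hp, rfl⟩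
  exact (coe_mul_mem_pseudoSSpectrum_smul_iff a ε hr p).2 hp
end
end

section
/- Let a ∈ A, let v ∈ A be invertible, set b = v⁻¹ a v and k = ‖v‖·‖v⁻¹‖. Then for every ε > 0: Λ_{ε/k}^S(a) ⊆ Λ_ε^S(b) ⊆ Λ_{εk}^S(a). (In particular σ_S(b) = σ_S(a).) -/
noncomputable section

theorem Qop_conj {A : Type*} [NormedRing A] [NormedAlgebra ℝ A] (a : A) (v : Aˣ)
    (q : Quaternion ℝ) :
    Qop (((v⁻¹ : Aˣ) : A) * a * (v : A)) q = ((v⁻¹ : Aˣ) : A) * Qop a q * (v : A) := by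
  simp only [Qop, mul_add, mul_sub, add_mul, sub_mul, mul_smul_comm, smul_mul_assoc, mul_one,
    Units.inv_mul, pow_two, mul_assoc, Units.mul_inv_cancel_left]

theorem isUnit_Qop_conj_iff {A : Type*} [NormedRing A] [NormedAlgebra ℝ A] (a : A) (v : Aˣ)
    (q : Quaternion ℝ) :
    IsUnit (Qop (((v⁻¹ : Aˣ) : A) * a * (v : A)) q) ↔ IsUnit (Qop a q) := by
  rw [Qop_conj, Units.isUnit_mul_units, Units.isUnit_units_mul]

theorem sSpectrum_conj {A : Type*} [NormedRing A] [NormedAlgebra ℝ A] (a : A) (v : Aˣ) :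
    sSpectrum (((v⁻¹ : Aˣ) : A) * a * (v : A)) = sSpectrum a :=
  Set.ext fun q => not_congr (isUnit_Qop_conj_iff a v q)

theorem ringInverse_units_conj {M : Type*} [MonoidWithZero M] {x : M} (hx : IsUnit x) (v : Mˣ) :
    Ring.inverse (((v⁻¹ : Mˣ) : M) * x * (v : M)) =
      ((v⁻¹ : Mˣ) : M) * Ring.inverse x * (v : M) := by
  obtain ⟨u, rfl⟩ := hx
  rw [← Units.val_mul, ← Units.val_mul, Ring.inverse_unit, Ring.inverse_unit, ← Units.val_mul,
    ← Units.val_mul]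
  congr 1
  group

theorem norm_units_conj_le {A : Type*} [NormedRing A] (x : A) (v : Aˣ) :
    ‖((v⁻¹ : Aˣ) : A) * x * (v : A)‖ ≤ (‖(v : A)‖ * ‖((v⁻¹ : Aˣ) : A)‖) * ‖x‖ :=
  calc
    _ ≤ ‖((v⁻¹ : Aˣ) : A)‖ * ‖x‖ * ‖(v : A)‖ := norm_mul₃_le
    _ = _ := by ring

theorem pseudoSSpectrum_conj_subset {A : Type*} [NormedRing A] [NormedAlgebra ℝ A] [Nontrivial A]
    (a : A) (v : Aˣ) (ε : ℝ) :
    pseudoSSpectrum ε (((v⁻¹ : Aˣ) : A) * a * (v : A)) ⊆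
      pseudoSSpectrum (ε * (‖(v : A)‖ * ‖((v⁻¹ : Aˣ) : A)‖)) a := by
  rintro q (hq | ⟨hq, hle⟩)
  · exact Or.inl (sSpectrum_conj a v ▸ hq)
  · rw [isUnit_Qop_conj_iff] at hq
    refine Or.inr ⟨hq, ?_⟩
    have hk : 0 < ‖(v : A)‖ * ‖((v⁻¹ : Aˣ) : A)‖ := mul_pos v.norm_pos v⁻¹.norm_pos
    rw [Qop_conj, ringInverse_units_conj hq] at hle
    rw [← div_div, div_le_iff₀' hk]
    exact hle.trans (norm_units_conj_le _ v)

theorem pseudoSSpectrum_conjugation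
    {A : Type*} [NormedRing A] [NormedAlgebra ℝ A] [CompleteSpace A] [NormOneClass A]
    (a : A) (v : Aˣ) (ε : ℝ) (hε : 0 < ε) :
    pseudoSSpectrum (ε / (‖(v : A)‖ * ‖((v⁻¹ : Aˣ) : A)‖)) a ⊆
        pseudoSSpectrum ε (((v⁻¹ : Aˣ) : A) * a * (v : A)) ∧
    pseudoSSpectrum ε (((v⁻¹ : Aˣ) : A) * a * (v : A)) ⊆
        pseudoSSpectrum (ε * (‖(v : A)‖ * ‖((v⁻¹ : Aˣ) : A)‖)) a ∧
    sSpectrum (((v⁻¹ : Aˣ) : A) * a * (v : A)) = sSpectrum a := by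
  have : Nontrivial A := NormOneClass.nontrivial
  refine ⟨?_, pseudoSSpectrum_conj_subset a v ε, sSpectrum_conj a v⟩
  have hk : ‖(v : A)‖ * ‖((v⁻¹ : Aˣ) : A)‖ ≠ 0 :=
    (mul_pos v.norm_pos v⁻¹.norm_pos).ne'
  have hconj : (v : A) * (((v⁻¹ : Aˣ) : A) * a * (v : A)) * ((v⁻¹ : Aˣ) : A) = a := by
    rw [mul_assoc _ a, Units.mul_inv_cancel_left, Units.mul_inv_cancel_right]
  have h := pseudoSSpectrum_conj_subset (((v⁻¹ : Aˣ) : A) * a * (v : A)) v⁻¹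
    (ε / (‖(v : A)‖ * ‖((v⁻¹ : Aˣ) : A)‖))
  rwa [inv_inv, mul_comm ‖((v⁻¹ : Aˣ) : A)‖, div_mul_cancel₀ _ hk, hconj] at h
end
end

section
/- Let a ∈ A and ε > 0. Then Λ_ε^S(a) ⊆ {q ∈ ℍ : |q| ≤ ‖a‖ + √ε}, and Λ_ε^S(a) is a closed, hence compact, subset of ℍ. -/
noncomputable section

open Polynomial Polynomial.Chebyshev in
/-- On `[-1, 1]` the Chebyshev polynomial `U n` is bounded by `n + 1`. -/
theorem abs_eval_U_real_le {t : ℝ} (ht : |t| ≤ 1) (n : ℕ) : |(U ℝ n).eval t| ≤ n + 1 := by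
  induction n with
  | zero => simp
  | succ n ih =>
    push_cast
    rw [U_eq_X_mul_U_add_T, eval_add, eval_mul, eval_X]
    have hT := abs_eval_T_real_le_one (n + 1) ht
    have hU : |t * (U ℝ n).eval t| ≤ n + 1 := by
      rw [abs_mul]
      exact (mul_le_of_le_one_left (abs_nonneg _) ht).trans ih
    exact (abs_add_le _ _).trans (add_le_add hU hT)

theorem continuous_Qop {A : Type*} [NormedRing A] [NormedAlgebra ℝ A] (a : A) :
    Continuous (Qop a) := by
  unfold Qop
  have : Continuous fun q : Quaternion ℝ ↦ q.re := Quaternion.continuous_re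
  fun_prop

section

variable {A : Type*} [NormedRing A] [NormedAlgebra ℝ A] [CompleteSpace A] [NormOneClass A]

open Polynomial Polynomial.Chebyshev in
/-- The generating series of the Chebyshev polynomials `U n` inverts `z² - 2 t z + 1`. -/
theorem exists_inverse_sq_sub_smul_add_one {z : A} (hz : ‖z‖ < 1) {t : ℝ} (ht : |t| ≤ 1) :
    ∃ S : A, (z ^ 2 - (2 * t) • z + 1) * S = 1 ∧ S * (z ^ 2 - (2 * t) • z + 1) = 1 ∧
      ‖S‖ ≤ 1 / (1 - ‖z‖) ^ 2 := by
  let f : ℕ → A := fun n ↦ (U ℝ n).eval t • z ^ n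
  have hbound : HasSum (fun n : ℕ ↦ ((n : ℝ) + 1) * ‖z‖ ^ n) (1 / (1 - ‖z‖) ^ 2) := by
    simpa using hasSum_choose_mul_geometric_of_norm_lt_one 1 (r := ‖z‖) (by simpa using hz)
  have hf : ∀ n, ‖f n‖ ≤ ((n : ℝ) + 1) * ‖z‖ ^ n := fun n ↦ by
    rw [norm_smul, Real.norm_eq_abs]
    gcongr
    · exact abs_eval_U_real_le ht n
    · exact norm_pow_le z n
  have hsum : Summable f := .of_norm_bounded hbound.summable hf
  have hS := hsum.hasSum
  set S := ∑' n, f n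
  have hcomm : Commute z S :=
    Commute.tsum_right _ fun n ↦ ((Commute.refl z).pow_right n).smul_right _
  have hrec : ∀ n, f (n + 2) = (2 * t) • (z * f (n + 1)) - z ^ 2 * f n := fun n ↦ by
    have h : (U ℝ ((n + 2 : ℕ) : ℤ)).eval t =
        2 * t * (U ℝ ((n + 1 : ℕ) : ℤ)).eval t - (U ℝ n).eval t := by
      push_cast
      rw [U_add_two]
      simp
    simp only [f, h, mul_smul_comm, smul_smul, ← pow_succ', ← pow_add, sub_smul]
    rw [add_comm 2 n]
  have h1 := (hasSum_nat_add_iff' 1).mpr hS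
  have h2 := (hasSum_nat_add_iff' 2).mpr hS
  have hmul : (z ^ 2 - (2 * t) • z + 1) * S = 1 := by
    have h := h2.unique (((h1.mul_left z).const_smul (2 * t)).sub (hS.mul_left (z ^ 2))
      |>.congr_fun hrec)
    simp only [Finset.sum_range_succ, Finset.sum_range_zero, f, Nat.cast_zero, Nat.cast_one,
      U_zero, U_one, eval_one, eval_mul, eval_X, eval_ofNat, pow_zero, pow_one, one_smul,
      zero_add, mul_sub, mul_one, smul_sub] at h
    rw [add_mul, sub_mul, smul_mul_assoc, one_mul]
    rw [sub_eq_iff_eq_add] at h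
    nth_rewrite 3 [h]
    abel
  refine ⟨S, hmul, Eq.trans ?_ hmul, hS.norm_le_of_bounded hbound hf⟩
  exact (((hcomm.pow_left 2).sub_left (hcomm.smul_left (2 * t))).add_left (Commute.one_left S)).symm

theorem abs_re_le_norm_quaternion (q : Quaternion ℝ) : |q.re| ≤ ‖q‖ := by
  refine abs_le_of_sq_le_sq ?_ (norm_nonneg q)
  rw [sq ‖q‖, ← Quaternion.normSq_eq_norm_mul_self, Quaternion.normSq_def']
  nlinarith [sq_nonneg q.imI, sq_nonneg q.imJ, sq_nonneg q.imK]

/-- Outside the ball of radius `‖a‖`, `Q_q(a)` is invertible with an explicit bound. -/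
theorem Qop_isUnit_and_norm_inverse_le {a : A} {q : Quaternion ℝ} (hq : ‖a‖ < ‖q‖) :
    IsUnit (Qop a q) ∧ ‖Ring.inverse (Qop a q)‖ ≤ 1 / (‖q‖ - ‖a‖) ^ 2 := by
  have hr : 0 < ‖q‖ := (norm_nonneg a).trans_lt hq
  have hnorm : ‖‖q‖⁻¹ • a‖ = ‖a‖ / ‖q‖ := by
    rw [norm_smul, norm_inv, norm_norm, div_eq_inv_mul]
  have ht : |q.re / ‖q‖| ≤ 1 := by
    rw [abs_div, abs_norm]
    exact div_le_one_of_le₀ (abs_re_le_norm_quaternion q) hr.le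
  obtain ⟨S, hS, hS', hle⟩ := exists_inverse_sq_sub_smul_add_one (z := ‖q‖⁻¹ • a)
    (by rwa [hnorm, div_lt_one hr]) ht
  have hQ : Qop a q = (‖q‖ ^ 2) •
      ((‖q‖⁻¹ • a) ^ 2 - (2 * (q.re / ‖q‖)) • (‖q‖⁻¹ • a) + 1) := by
    rw [Qop, smul_add, smul_sub, smul_pow, smul_smul, smul_smul, smul_smul]
    congr 2
    · rw [← mul_pow, mul_inv_cancel₀ hr.ne', one_pow, one_smul]
    · congr 1
      field_simp
  have hr2 : ‖q‖ ^ 2 ≠ 0 := by positivity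
  let u : Aˣ := ⟨Qop a q, (‖q‖ ^ 2)⁻¹ • S,
    by rw [hQ, smul_mul_smul_comm, hS, mul_inv_cancel₀ hr2, one_smul],
    by rw [hQ, smul_mul_smul_comm, hS', inv_mul_cancel₀ hr2, one_smul]⟩
  refine ⟨u.isUnit, ?_⟩
  have hinv : Ring.inverse (Qop a q) = (‖q‖ ^ 2)⁻¹ • S := Ring.inverse_unit u
  rw [hinv, norm_smul, norm_inv, norm_pow, norm_norm]
  rw [hnorm] at hle
  calc (‖q‖ ^ 2)⁻¹ * ‖S‖ ≤ (‖q‖ ^ 2)⁻¹ * (1 / (1 - ‖a‖ / ‖q‖) ^ 2) := by gcongr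
    _ = 1 / (‖q‖ - ‖a‖) ^ 2 := by
      rw [one_div, one_div, ← mul_inv, ← mul_pow, mul_sub, mul_one, mul_div_cancel₀ _ hr.ne']

theorem pseudoSSpectrum_subset_closedBall (a : A) {ε : ℝ} (hε : 0 < ε) :
    pseudoSSpectrum ε a ⊆ {q : Quaternion ℝ | ‖q‖ ≤ ‖a‖ + Real.sqrt ε} := by
  intro q hq
  by_contra hnot
  have hlt : ‖a‖ + Real.sqrt ε < ‖q‖ := not_le.mp hnot
  have hsqrt := Real.sqrt_pos.mpr hε
  obtain ⟨hu, hle⟩ := Qop_isUnit_and_norm_inverse_le (a := a) (q := q) (by linarith)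
  rcases hq with hq | ⟨-, hq⟩
  · exact hq hu
  · have h : ε < (‖q‖ - ‖a‖) ^ 2 := by
      rw [← Real.sqrt_lt' (by linarith)]
      linarith
    exact absurd (hq.trans hle) (not_le.mpr (one_div_lt_one_div_of_lt hε h))

end

theorem isClosed_pseudoSSpectrum {A : Type*} [NormedRing A] [NormedAlgebra ℝ A] [CompleteSpace A]
    (a : A) (ε : ℝ) : IsClosed (pseudoSSpectrum ε a) := by
  have hcompl : (pseudoSSpectrum ε a)ᶜ =
      {q | IsUnit (Qop a q) ∧ ‖Ring.inverse (Qop a q)‖ < 1 / ε} := by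
    ext q
    simp only [pseudoSSpectrum, sSpectrum, Set.mem_compl_iff, Set.mem_union, Set.mem_ofPred_eq,
      ← not_le]
    tauto
  rw [← isOpen_compl_iff, hcompl, isOpen_iff_mem_nhds]
  rintro q ⟨⟨u, hu⟩, hlt⟩
  have hcont := (continuous_Qop a).continuousAt (x := q)
  have hinv : ContinuousAt (fun p ↦ ‖Ring.inverse (Qop a p)‖) q :=
    (ContinuousAt.comp (hu ▸ NormedRing.inverse_continuousAt u) hcont).norm
  exact (hcont.eventually (Units.isOpen.mem_nhds ⟨u, hu⟩)).and
    (hinv.eventually (Iio_mem_nhds hlt))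

theorem pseudoSSpectrum_subset_ball_and_compact
    {A : Type*} [NormedRing A] [NormedAlgebra ℝ A] [CompleteSpace A] [NormOneClass A]
    (a : A) (ε : ℝ) (hε : 0 < ε) :
    pseudoSSpectrum ε a ⊆ {q : Quaternion ℝ | ‖q‖ ≤ ‖a‖ + Real.sqrt ε} ∧
    IsClosed (pseudoSSpectrum ε a) ∧ IsCompact (pseudoSSpectrum ε a) := by
  have hclosed := isClosed_pseudoSSpectrum a ε
  have hsub := pseudoSSpectrum_subset_closedBall a hε
  have : ProperSpace (Quaternion ℝ) := FiniteDimensional.proper ℝ _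
  refine ⟨hsub, hclosed,
    (isCompact_closedBall 0 (‖a‖ + Real.sqrt ε)).of_isClosed_subset hclosed ?_⟩
  intro q hq
  rw [mem_closedBall_zero_iff]
  exact hsub hq
end
end

section
/- Let q ∈ ℍ be viewed as an element of the real Banach algebra ℍ (this models the left multiplication operator L_q, which satisfies ‖Q_p(L_q)⁻¹‖ = ‖Q_p(q)⁻¹‖ = ‖Q_p(q)‖⁻¹). Then for every ε > 0: Λ_ε^S(q) = {p ∈ ℍ : ‖q² − 2 (Re p) q + |p|²‖ ≤ ε}. (This identifies Λ_ε^S(L_q) with the ε-sphere S^ℍ([q], ε) around the similarity class [q].) -/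
noncomputable section

theorem Qop_quaternion (q p : Quaternion ℝ) :
    Qop q p = q ^ 2 - 2 * (p.re : Quaternion ℝ) * q + ((‖p‖ ^ 2 : ℝ) : Quaternion ℝ) := by
  have h : (2 * (p.re : Quaternion ℝ)) = ((2 * p.re : ℝ) : Quaternion ℝ) := by
    push_cast
    rfl
  rw [Qop, h, Quaternion.coe_mul_eq_smul, ← Quaternion.coe_mul_eq_smul (‖p‖ ^ 2), mul_one]

theorem pseudoSSpectrum_quaternion (q : Quaternion ℝ) (ε : ℝ) (hε : 0 < ε) :
    pseudoSSpectrum ε q =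
      {p : Quaternion ℝ |
        ‖q ^ 2 - 2 * (p.re : Quaternion ℝ) * q + ((‖p‖ ^ 2 : ℝ) : Quaternion ℝ)‖ ≤ ε} := by
  ext p
  simp only [pseudoSSpectrum, sSpectrum, Set.mem_union, Set.mem_ofPred_eq, ← Qop_quaternion,
    isUnit_iff_ne_zero, Ring.inverse_eq_inv', norm_inv, one_div]
  by_cases h : Qop q p = 0
  · simp [h, hε.le]
  · simp [h, inv_le_inv₀ hε (norm_pos_iff.mpr h)]
end
end

section
/- Let K ⊆ ℝ be a nonempty compact set and ε > 0. Then {q ∈ ℍ : inf_{r ∈ K} |r² − 2 (Re q) r + |q|²| ≤ ε} = ⋃_{r ∈ K} closedBall((r : ℍ), √ε). (This is the set-theoretic content of the theorem that for a self-adjoint quaternionic operator T, whose S-spectrum is a nonempty compact subset of ℝ, the ε-pseudo S-spectrum Λ_ε^S(T) = S^ℍ(σ_S(T), ε) equals the union over r ∈ σ_S(T) of the circularizations Ω_{D(r,√ε)}, each of which is the closed ball of radius √ε around r in ℍ.) -/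
noncomputable section

theorem Quaternion.norm_sub_coe_sq (q : Quaternion ℝ) (r : ℝ) :
    ‖q - (r : Quaternion ℝ)‖ ^ 2 = r ^ 2 - 2 * q.re * r + ‖q‖ ^ 2 := by
  simp only [sq ‖_‖, ← Quaternion.normSq_eq_norm_mul_self, Quaternion.normSq_def']
  simp
  ring

theorem epsSphere_real_compact_eq_union_closedBall
    (K : Set ℝ) (hK : K.Nonempty) (hKc : IsCompact K) (ε : ℝ) (hε : 0 < ε) :
    {q : Quaternion ℝ |
        sInf ((fun r : ℝ => |r ^ 2 - 2 * q.re * r + ‖q‖ ^ 2|) '' K) ≤ ε} =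
      ⋃ r ∈ K, Metric.closedBall ((r : Quaternion ℝ)) (Real.sqrt ε) := by
  ext q
  have mem_ball_iff (r : ℝ) : q ∈ Metric.closedBall (r : Quaternion ℝ) (Real.sqrt ε) ↔
      |r ^ 2 - 2 * q.re * r + ‖q‖ ^ 2| ≤ ε := by
    rw [← Quaternion.norm_sub_coe_sq, abs_of_nonneg (sq_nonneg _), mem_closedBall_iff_norm,
      Real.le_sqrt (norm_nonneg _) hε.le]
  simp only [Set.mem_ofPred_eq, Set.mem_iUnion, exists_prop, mem_ball_iff]
  constructor
  · intro h
    obtain ⟨r, hr, hmin⟩ := hKc.exists_sInf_image_eq hK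
      (f := fun r : ℝ => |r ^ 2 - 2 * q.re * r + ‖q‖ ^ 2|) (by fun_prop)
    exact ⟨r, hr, hmin ▸ h⟩
  · rintro ⟨r, hr, h⟩
    refine (csInf_le ⟨0, ?_⟩ (Set.mem_image_of_mem _ hr)).trans h
    rintro _ ⟨s, -, rfl⟩
    exact abs_nonneg _
end
end

section
/- Let q ∈ ℍ and ε > 0, and let S = {r ∈ ℝ : |r² − 2 (Re q) r + |q|²| ≤ ε} (the intersection of the ε-pseudo S-spectrum of the left multiplication operator L_q with the real line). If ε < |Im q|², then S is empty. If ε ≥ |Im q|², then S is nonempty and connected. -/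
noncomputable section

theorem Quaternion.norm_sq_eq_re_sq_add_norm_im_sq (q : Quaternion ℝ) :
    ‖q‖ ^ 2 = q.re ^ 2 + ‖q.im‖ ^ 2 := by
  simp only [sq ‖q‖, sq ‖q.im‖, ← Quaternion.normSq_eq_norm_mul_self, Quaternion.normSq_def',
    Quaternion.re_im, Quaternion.imI_im, Quaternion.imJ_im, Quaternion.imK_im]
  ring

theorem Quaternion.abs_real_quadratic_eq (q : Quaternion ℝ) (r : ℝ) :
    |r ^ 2 - 2 * q.re * r + ‖q‖ ^ 2| = (r - q.re) ^ 2 + ‖q.im‖ ^ 2 := by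
  rw [← abs_of_nonneg (by positivity : 0 ≤ (r - q.re) ^ 2 + ‖q.im‖ ^ 2),
    q.norm_sq_eq_re_sq_add_norm_im_sq]
  ring_nf

theorem real_points_of_pseudoSSpectrum_left_mul (q : Quaternion ℝ) (ε : ℝ) (hε : 0 < ε) :
    (ε < ‖q.im‖ ^ 2 → {r : ℝ | |r ^ 2 - 2 * q.re * r + ‖q‖ ^ 2| ≤ ε} = ∅) ∧
    (‖q.im‖ ^ 2 ≤ ε →
      ({r : ℝ | |r ^ 2 - 2 * q.re * r + ‖q‖ ^ 2| ≤ ε}).Nonempty ∧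
      IsConnected {r : ℝ | |r ^ 2 - 2 * q.re * r + ‖q‖ ^ 2| ≤ ε}) := by
  simp only [Quaternion.abs_real_quadratic_eq]
  refine ⟨fun h => Set.eq_empty_of_forall_notMem fun r hr => ?_, fun h => ?_⟩
  · rw [Set.mem_ofPred_eq] at hr
    linarith [sq_nonneg (r - q.re)]
  · have hS : {r : ℝ | (r - q.re) ^ 2 + ‖q.im‖ ^ 2 ≤ ε} =
        Set.Icc (q.re - √(ε - ‖q.im‖ ^ 2)) (q.re + √(ε - ‖q.im‖ ^ 2)) := by
      ext r
      rw [Set.mem_ofPred_eq, ← le_sub_iff_add_le, Real.sq_le (sub_nonneg.2 h), Set.mem_Icc]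
      constructor <;> rintro ⟨h₁, h₂⟩ <;> constructor <;> linarith
    have hc := isConnected_Icc (a := q.re - √(ε - ‖q.im‖ ^ 2))
      (b := q.re + √(ε - ‖q.im‖ ^ 2)) (by linarith [Real.sqrt_nonneg (ε - ‖q.im‖ ^ 2)])
    rw [hS]
    exact ⟨hc.nonempty, hc⟩
end
end

section
/- Let 𝕊 = {m ∈ ℍ : m² = −1} (the unit sphere of purely imaginary quaternions). For every r ∈ ℝ and every m ∈ 𝕊, ‖m² − 2 r m + r²‖ = ‖m − r‖² = 1 + r²; consequently, for ε > 0 the set S^ℍ(𝕊, ε) ∩ ℝ = {r ∈ ℝ : inf_{m ∈ 𝕊} ‖m² − 2 r m + r²‖ ≤ ε} is empty if and only if ε < 1. -/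
noncomputable section

/-- A quaternion squaring to `-1` is purely imaginary of unit length. -/
lemma Quaternion.re_eq_zero_and_sum_sq_of_sq_eq_neg_one {m : Quaternion ℝ} (h : m ^ 2 = -1) :
    m.re = 0 ∧ m.imI ^ 2 + m.imJ ^ 2 + m.imK ^ 2 = 1 := by
  rw [pow_two] at h
  have h0 := congrArg (fun q : Quaternion ℝ => q.re) h
  have h1 := congrArg (fun q : Quaternion ℝ => q.imI) h
  have h2 := congrArg (fun q : Quaternion ℝ => q.imJ) h
  have h3 := congrArg (fun q : Quaternion ℝ => q.imK) h
  simp at h0 h1 h2 h3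
  have hre : m.re = 0 := by
    by_contra hne
    have hI : m.imI = 0 := mul_left_cancel₀ hne (by linarith)
    have hJ : m.imJ = 0 := mul_left_cancel₀ hne (by linarith)
    have hK : m.imK = 0 := mul_left_cancel₀ hne (by linarith)
    rw [hI, hJ, hK] at h0
    nlinarith [sq_nonneg m.re]
  rw [hre] at h0
  exact ⟨hre, by linarith⟩

lemma Quaternion.norm_sub_coe_sq_of_sq_eq_neg_one {m : Quaternion ℝ} (h : m ^ 2 = -1) (r : ℝ) :
    ‖m - (r : Quaternion ℝ)‖ ^ 2 = 1 + r ^ 2 := by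
  obtain ⟨hre, hsum⟩ := Quaternion.re_eq_zero_and_sum_sq_of_sq_eq_neg_one h
  rw [pow_two, ← Quaternion.normSq_eq_norm_mul_self, Quaternion.normSq_def']
  simp [hre]
  linarith

lemma Quaternion.sq_sub_two_mul_coe_mul_add_sq (m : Quaternion ℝ) (r : ℝ) :
    m ^ 2 - 2 * (r : Quaternion ℝ) * m + (r : Quaternion ℝ) ^ 2 = (m - r) ^ 2 := by
  have hc : m * (r : Quaternion ℝ) = r * m := (Quaternion.coe_commutes r m).symm
  simp only [pow_two, sub_mul, mul_sub, two_mul, add_mul, hc]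
  abel

theorem epsSphere_unitSphere_inter_real (ε : ℝ) (hε : 0 < ε) :
    (∀ r : ℝ, ∀ m : Quaternion ℝ, m ^ 2 = -1 →
      ‖m ^ 2 - 2 * (r : Quaternion ℝ) * m + ((r : Quaternion ℝ)) ^ 2‖ =
          ‖m - (r : Quaternion ℝ)‖ ^ 2 ∧
        ‖m - (r : Quaternion ℝ)‖ ^ 2 = 1 + r ^ 2) ∧
    ({r : ℝ |
        sInf ((fun m : Quaternion ℝ =>
          ‖m ^ 2 - 2 * (r : Quaternion ℝ) * m + ((r : Quaternion ℝ)) ^ 2‖) ''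
            {m : Quaternion ℝ | m ^ 2 = -1}) ≤ ε} = ∅ ↔ ε < 1) := by
  have key : ∀ r : ℝ, ∀ m : Quaternion ℝ, m ^ 2 = -1 →
      ‖m ^ 2 - 2 * (r : Quaternion ℝ) * m + ((r : Quaternion ℝ)) ^ 2‖ = 1 + r ^ 2 := by
    intro r m hm
    rw [Quaternion.sq_sub_two_mul_coe_mul_add_sq, norm_pow,
      Quaternion.norm_sub_coe_sq_of_sq_eq_neg_one hm]
  have hne : {m : Quaternion ℝ | m ^ 2 = -1}.Nonempty := by
    obtain ⟨i, h0, h1, h2, h3⟩ :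
        ∃ i : Quaternion ℝ, i.re = 0 ∧ i.imI = 1 ∧ i.imJ = 0 ∧ i.imK = 0 :=
      ⟨⟨0, 1, 0, 0⟩, rfl, rfl, rfl, rfl⟩
    refine ⟨i, ?_⟩
    rw [Set.mem_ofPred_eq, pow_two]
    apply Quaternion.ext <;>
      simp [h0, h1, h2, h3, Quaternion.re_one, Quaternion.imI_one, Quaternion.imJ_one,
        Quaternion.imK_one]
  refine ⟨fun r m hm => ?_, ?_⟩
  · have h := Quaternion.norm_sub_coe_sq_of_sq_eq_neg_one hm r
    exact ⟨(key r m hm).trans h.symm, h⟩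
  · have hinf : ∀ r : ℝ, sInf ((fun m : Quaternion ℝ =>
          ‖m ^ 2 - 2 * (r : Quaternion ℝ) * m + ((r : Quaternion ℝ)) ^ 2‖) ''
            {m : Quaternion ℝ | m ^ 2 = -1}) = 1 + r ^ 2 := fun r => by
      have himage := Set.image_congr (s := {m : Quaternion ℝ | m ^ 2 = -1})
        (g := fun _ => 1 + r ^ 2) (fun m hm => key r m hm)
      rw [himage, hne.image_const, csInf_singleton]
    simp only [hinf, Set.eq_empty_iff_forall_notMem, Set.mem_ofPred_eq, not_le]
    exact ⟨fun h => by simpa using h 0, fun h r => by nlinarith [sq_nonneg r]⟩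
end
end

section
/- Let q, q' ∈ ℍ with Re q = Re q' and |q| = |q'| (i.e., q and q' are similar quaternions). Then for every p ∈ ℍ: ‖q² − 2 (Re p) q + |p|²‖ = ‖q'² − 2 (Re p) q' + |p|²‖. (Hence the ε-pseudo S-spectrum of the left multiplication operator L_q depends only on the similarity class [q], and equals S^ℍ([q], ε).) -/
noncomputable section

/-- A quaternion satisfies its real characteristic polynomial. -/
theorem Quaternion.sq_eq_two_mul_re_mul_sub_normSq (q : Quaternion ℝ) :
    q ^ 2 = ((2 * q.re : ℝ) : Quaternion ℝ) * q - ((Quaternion.normSq q : ℝ) : Quaternion ℝ) := by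
  rw [← Quaternion.self_mul_star, Quaternion.star_eq_two_re_sub, mul_sub,
    ← Quaternion.coe_commutes]
  push_cast
  noncomm_ring

theorem Quaternion.normSq_coe_mul_add_coe (a b : ℝ) (q : Quaternion ℝ) :
    Quaternion.normSq ((a : Quaternion ℝ) * q + (b : Quaternion ℝ)) =
      a ^ 2 * Quaternion.normSq q + 2 * a * b * q.re + b ^ 2 := by
  simp only [Quaternion.normSq_def', Quaternion.re_add, Quaternion.imI_add, Quaternion.imJ_add,
    Quaternion.imK_add, Quaternion.coe_mul_eq_smul, Quaternion.re_smul, Quaternion.imI_smul,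
    Quaternion.imJ_smul, Quaternion.imK_smul, Quaternion.re_coe, Quaternion.imI_coe,
    Quaternion.imJ_coe, Quaternion.imK_coe, smul_eq_mul]
  ring

/-- The squared norm of `q ^ 2 - 2 s q + t`, for real `s` and `t`, in terms of the real part and
the norm of `q`. -/
theorem Quaternion.norm_sq_sub_two_mul_add_sq (q : Quaternion ℝ) (s t : ℝ) :
    ‖q ^ 2 - 2 * (s : Quaternion ℝ) * q + (t : Quaternion ℝ)‖ ^ 2 =
      (2 * (q.re - s)) ^ 2 * ‖q‖ ^ 2 + 2 * (2 * (q.re - s)) * (t - ‖q‖ ^ 2) * q.re +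
        (t - ‖q‖ ^ 2) ^ 2 := by
  have h : q ^ 2 - 2 * (s : Quaternion ℝ) * q + (t : Quaternion ℝ) =
      ((2 * (q.re - s) : ℝ) : Quaternion ℝ) * q +
        ((t - Quaternion.normSq q : ℝ) : Quaternion ℝ) := by
    have h_two : ((2 : ℝ) : Quaternion ℝ) = 2 := rfl
    rw [Quaternion.sq_eq_two_mul_re_mul_sub_normSq]
    push_cast
    rw [h_two]
    noncomm_ring
  have hn (x : Quaternion ℝ) : ‖x‖ ^ 2 = Quaternion.normSq x := by
    rw [Quaternion.normSq_eq_norm_mul_self, sq]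
  rw [hn, hn, h, Quaternion.normSq_coe_mul_add_coe]

theorem norm_Q_eq_of_similar (q q' : Quaternion ℝ)
    (hre : q.re = q'.re) (hnorm : ‖q‖ = ‖q'‖) (p : Quaternion ℝ) :
    ‖q ^ 2 - 2 * (p.re : Quaternion ℝ) * q + ((‖p‖ ^ 2 : ℝ) : Quaternion ℝ)‖ =
      ‖q' ^ 2 - 2 * (p.re : Quaternion ℝ) * q' + ((‖p‖ ^ 2 : ℝ) : Quaternion ℝ)‖ := by
  rw [← sq_eq_sq₀ (norm_nonneg _) (norm_nonneg _), Quaternion.norm_sq_sub_two_mul_add_sq,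
    Quaternion.norm_sq_sub_two_mul_add_sq, hre, hnorm]
end
end

section
/- Let a ∈ A and r ∈ ℝ. Suppose that for every ε > 0 the ε-pseudo S-spectrum of a equals the closed ball of radius √ε centered at (r : ℍ), i.e., Λ_ε^S(a) = {q ∈ ℍ : ‖q − r‖ ≤ √ε} for all ε > 0. Then a = r • 1. (This is the statement that an operator whose ε-pseudo S-spectrum is the circularization Ω_{D(r,√ε)} for every ε > 0 must be the left multiplication operator L_r induced by the real number r.) -/
noncomputable section

section

variable {A : Type*} [NormedRing A] [NormedAlgebra ℝ A]

/-- `(1 - z b) (1 - z̄ b)`, computed in `A` itself. -/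
def quad (b : A) (z : ℂ) : A := 1 - (2 * z.re) • b + Complex.normSq z • b ^ 2

/-- The real part of `(1 - z b)⁻¹` in the complexification of `A`. -/
def resolventRe (b : A) (z : ℂ) : A := Ring.inverse (quad b z) * (1 - z.re • b)

/-- The imaginary part of `(1 - z b)⁻¹` in the complexification of `A`. -/
def resolventIm (b : A) (z : ℂ) : A := Ring.inverse (quad b z) * (z.im • b)

theorem Commute.ringInverse_quad {b : A} {z : ℂ} (h : IsUnit (quad b z)) :
    Commute (Ring.inverse (quad b z)) b := by
  obtain ⟨u, hu⟩ := h
  have : Commute b (u : A) := by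
    rw [hu, quad]
    exact ((Commute.one_right b).sub_right ((Commute.refl b).smul_right _)).add_right
      (((Commute.refl b).pow_right 2).smul_right _)
  rw [← hu, Ring.inverse_unit]
  exact this.units_inv_right.symm

theorem resolventRe_mul_add {b : A} {z : ℂ} (h : IsUnit (quad b z)) :
    resolventRe b z * (1 - z.re • b) + resolventIm b z * (z.im • b) = 1 := by
  refine Eq.trans ?_ (Ring.inverse_mul_cancel _ h)
  simp only [resolventRe, resolventIm, mul_assoc, ← mul_add]
  congr 1
  simp only [quad, Complex.normSq_apply, pow_two, mul_sub, sub_mul, smul_mul_smul_comm, one_mul,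
    mul_one]
  module

theorem resolventRe_mul_sub (b : A) (z : ℂ) :
    resolventRe b z * (z.im • b) - resolventIm b z * (1 - z.re • b) = 0 := by
  simp only [resolventRe, resolventIm, mul_assoc, ← mul_sub]
  convert mul_zero (Ring.inverse (quad b z)) using 2
  simp only [mul_sub, sub_mul, smul_mul_smul_comm, one_mul, mul_one]
  module

theorem Commute.resolventRe {b : A} {z : ℂ} (h : IsUnit (quad b z)) :
    Commute (resolventRe b z) b :=
  (Commute.ringInverse_quad h).mul_left
    ((Commute.one_left b).sub_left ((Commute.refl b).smul_left _))

theorem Commute.resolventIm {b : A} {z : ℂ} (h : IsUnit (quad b z)) :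
    Commute (resolventIm b z) b :=
  (Commute.ringInverse_quad h).mul_left ((Commute.refl b).smul_left _)

theorem resolventRe_eq {b : A} {z : ℂ} (h : IsUnit (quad b z)) :
    resolventRe b z = 1 + z.re • (b * resolventRe b z) - z.im • (b * resolventIm b z) := by
  have := resolventRe_mul_add h
  simp only [mul_sub, mul_one, mul_smul_comm, (Commute.resolventRe h).eq,
    (Commute.resolventIm h).eq] at this
  rw [← this]
  abel

theorem resolventIm_eq {b : A} {z : ℂ} (h : IsUnit (quad b z)) :
    resolventIm b z = z.re • (b * resolventIm b z) + z.im • (b * resolventRe b z) := by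
  have := resolventRe_mul_sub b z
  simp only [mul_sub, mul_one, mul_smul_comm, (Commute.resolventRe h).eq,
    (Commute.resolventIm h).eq] at this
  rw [← sub_eq_zero, ← neg_eq_zero, ← this]
  abel

theorem resolventRe_sub {b : A} {z w : ℂ} (hz : IsUnit (quad b z)) (hw : IsUnit (quad b w)) :
    resolventRe b w - resolventRe b z =
      (w - z).re • (resolventRe b w * b * resolventRe b z
        - resolventIm b w * b * resolventIm b z)
      - (w - z).im • (resolventRe b w * b * resolventIm b z
        + resolventIm b w * b * resolventRe b z) := by
  have e1 := resolventRe_mul_add hw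
  have e2 := resolventRe_mul_sub b w
  have e3 := resolventRe_eq hz
  have e4 := resolventIm_eq hz
  generalize resolventRe b w = P' at *
  generalize resolventIm b w = Q' at *
  generalize resolventRe b z = P at *
  generalize resolventIm b z = Q at *
  have f1 := congrArg (· * P) e1
  have f2 := congrArg (· * Q) e2
  have f3 := congrArg (P' * ·) e3
  have f4 := congrArg (Q' * ·) e4
  simp only [mul_sub, sub_mul, mul_add, add_mul, mul_one, one_mul, mul_smul_comm, smul_mul_assoc,
    zero_mul, ← mul_assoc] at f1 f2 f3 f4
  simp only [Complex.sub_re, Complex.sub_im]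
  linear_combination (norm := module) f1 - f3 + f2 + f4

theorem resolventIm_sub {b : A} {z w : ℂ} (hz : IsUnit (quad b z)) (hw : IsUnit (quad b w)) :
    resolventIm b w - resolventIm b z =
      (w - z).re • (resolventRe b w * b * resolventIm b z
        + resolventIm b w * b * resolventRe b z)
      + (w - z).im • (resolventRe b w * b * resolventRe b z
        - resolventIm b w * b * resolventIm b z) := by
  have e1 := resolventRe_mul_add hw
  have e2 := resolventRe_mul_sub b w
  have e3 := resolventRe_eq hz
  have e4 := resolventIm_eq hz
  generalize resolventRe b w = P' at *
  generalize resolventIm b w = Q' at *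
  generalize resolventRe b z = P at *
  generalize resolventIm b z = Q at *
  have f1 := congrArg (· * Q) e1
  have f2 := congrArg (· * P) e2
  have f3 := congrArg (Q' * ·) e3
  have f4 := congrArg (P' * ·) e4
  simp only [mul_sub, sub_mul, mul_add, add_mul, mul_one, one_mul, mul_smul_comm, smul_mul_assoc,
    zero_mul, ← mul_assoc] at f1 f2 f3 f4
  simp only [Complex.sub_re, Complex.sub_im]
  linear_combination (norm := module) f1 - f2 - f3 - f4

/-- The value of a real functional, extended complex-linearly, at the complexified resolvent. -/
def dualResolvent (φ : A →L[ℝ] ℝ) (b : A) (z : ℂ) : ℂ :=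
  φ (resolventRe b z) + φ (resolventIm b z) * Complex.I

theorem norm_dualResolvent_le {b : A} {z : ℂ} (hn : ‖Ring.inverse (quad b z)‖ ≤ 1)
    (φ : A →L[ℝ] ℝ) :
    ‖dualResolvent φ b z‖ ≤ ‖φ‖ * (‖(1 : A)‖ + 2 * ‖z‖ * ‖b‖) := by
  have hP : ‖resolventRe b z‖ ≤ ‖(1 : A)‖ + ‖z‖ * ‖b‖ := by
    refine (norm_mul_le_of_le hn (norm_sub_le _ _)).trans ?_
    rw [one_mul, norm_smul, Real.norm_eq_abs]
    gcongr
    exact Complex.abs_re_le_norm z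
  have hQ : ‖resolventIm b z‖ ≤ ‖z‖ * ‖b‖ := by
    refine (norm_mul_le_of_le hn le_rfl).trans ?_
    rw [one_mul, norm_smul, Real.norm_eq_abs]
    gcongr
    exact Complex.abs_im_le_norm z
  calc ‖dualResolvent φ b z‖ ≤ ‖φ (resolventRe b z)‖ + ‖φ (resolventIm b z)‖ := by
        refine (norm_add_le _ _).trans_eq ?_
        simp
    _ ≤ ‖φ‖ * (‖(1 : A)‖ + ‖z‖ * ‖b‖) + ‖φ‖ * (‖z‖ * ‖b‖) :=
        add_le_add (φ.le_opNorm_of_le hP) (φ.le_opNorm_of_le hQ)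
    _ = _ := by ring

theorem dualResolvent_eq {b : A} {z : ℂ} (h : IsUnit (quad b z)) (φ : A →L[ℝ] ℝ) :
    dualResolvent φ b z
      = φ 1 + z * dualResolvent (φ ∘L ContinuousLinearMap.mul ℝ A b) b z := by
  have e1 := congrArg φ (resolventRe_eq h)
  have e2 := congrArg φ (resolventIm_eq h)
  rw [map_sub, map_add, map_smul, map_smul] at e1
  rw [map_add, map_smul, map_smul] at e2
  apply Complex.ext
  · simp [dualResolvent] at e1 ⊢
    linarith
  · simp [dualResolvent] at e2 ⊢
    linarith

end

section
open Filter Topology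

variable {A : Type*} [NormedRing A] [NormedAlgebra ℝ A] [CompleteSpace A]

theorem continuous_inverse_quad {b : A} (h : ∀ z, IsUnit (quad b z)) :
    Continuous fun z => Ring.inverse (quad b z) := by
  have hq : Continuous (quad b) := by
    unfold quad
    have := Complex.continuous_normSq
    fun_prop
  refine continuous_iff_continuousAt.2 fun z => ?_
  obtain ⟨u, hu⟩ := h z
  have := NormedRing.inverse_continuousAt u
  rw [hu] at this
  exact this.comp hq.continuousAt

theorem continuous_resolventRe {b : A} (h : ∀ z, IsUnit (quad b z)) :
    Continuous (resolventRe b) := by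
  have := continuous_inverse_quad h
  unfold resolventRe
  fun_prop

theorem continuous_resolventIm {b : A} (h : ∀ z, IsUnit (quad b z)) :
    Continuous (resolventIm b) := by
  have := continuous_inverse_quad h
  unfold resolventIm
  fun_prop

theorem differentiable_dualResolvent {b : A} (h : ∀ z, IsUnit (quad b z)) (φ : A →L[ℝ] ℝ) :
    Differentiable ℂ (dualResolvent φ b) := by
  intro z
  let g : ℂ → ℂ := fun w =>
    φ (resolventRe b w * b * resolventRe b z - resolventIm b w * b * resolventIm b z)
      + φ (resolventRe b w * b * resolventIm b z + resolventIm b w * b * resolventRe b z)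
        * Complex.I
  have hg : Continuous g := by
    have := continuous_resolventRe h
    have := continuous_resolventIm h
    fun_prop
  have key : ∀ w, dualResolvent φ b w - dualResolvent φ b z = (w - z) * g w := by
    intro w
    have e1 := congrArg φ (resolventRe_sub (h z) (h w))
    have e2 := congrArg φ (resolventIm_sub (h z) (h w))
    rw [map_sub, map_sub, map_smul, map_smul] at e1
    rw [map_sub, map_add, map_smul, map_smul] at e2
    apply Complex.ext
    · simpa [dualResolvent, g] using e1
    · simp [dualResolvent, g] at e2 ⊢
      linarith
  refine HasDerivAt.differentiableAt (f' := g z) ?_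
  rw [hasDerivAt_iff_tendsto_slope]
  refine (hg.continuousAt.tendsto.mono_left nhdsWithin_le_nhds).congr' ?_
  filter_upwards [self_mem_nhdsWithin] with w hw
  rw [slope_def_field, key, mul_div_cancel_left₀ _ (sub_ne_zero.2 hw)]

/-- The functional `φ` at `b² (1 - z b)⁻¹ = z⁻² ((1 - z b)⁻¹ - 1 - z b)` is entire in `z` and tends
to `0` at infinity, so it vanishes by the Liouville theorem. -/
theorem sq_eq_zero_of_norm_inverse_quad_le {b : A} (h : ∀ z, IsUnit (quad b z))
    (hn : ∀ z, ‖Ring.inverse (quad b z)‖ ≤ 1) : b ^ 2 = 0 := by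
  refine SeparatingDual.eq_zero_of_forall_dual_eq_zero (R := ℝ) fun φ => ?_
  set L := ContinuousLinearMap.mul ℝ A b
  have hlim : Tendsto (dualResolvent ((φ ∘L L) ∘L L) b) (cocompact ℂ) (𝓝 0) := by
    have hinv : Tendsto (fun z : ℂ => ‖z‖⁻¹) (cocompact ℂ) (𝓝 0) :=
      tendsto_inv_atTop_zero.comp (tendsto_norm_cocompact_atTop)
    have hbound : Tendsto (fun z : ℂ => ‖z‖⁻¹ * (‖z‖⁻¹ * (‖φ‖ * ‖(1 : A)‖ + ‖φ 1‖)
        + (‖φ‖ * (2 * ‖b‖) + ‖φ b‖))) (cocompact ℂ) (𝓝 0) := by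
      simpa using hinv.mul ((hinv.mul_const (‖φ‖ * ‖(1 : A)‖ + ‖φ 1‖)).add_const
        (‖φ‖ * (2 * ‖b‖) + ‖φ b‖))
    refine squeeze_zero_norm' ?_ hbound
    filter_upwards [(Set.finite_singleton (0 : ℂ)).isCompact.compl_mem_cocompact] with z hz
    have hz : 0 < ‖z‖ := norm_pos_iff.2 hz
    have e : z ^ 2 * dualResolvent ((φ ∘L L) ∘L L) b z
        = dualResolvent φ b z - φ 1 - z * φ b := by
      have e1 := dualResolvent_eq (h z) φ
      have e2 := dualResolvent_eq (h z) (φ ∘L L)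
      have : (φ ∘L L) 1 = φ b := by simp [L]
      rw [this] at e2
      linear_combination -e1 - z * e2
    have e' := congrArg norm e
    rw [norm_mul, norm_pow] at e'
    have hle : ‖z‖ ^ 2 * ‖dualResolvent ((φ ∘L L) ∘L L) b z‖ ≤
        ‖φ‖ * (‖(1 : A)‖ + 2 * ‖z‖ * ‖b‖) + ‖φ 1‖ + ‖z‖ * ‖φ b‖ := by
      rw [e']
      have h1 := norm_sub_le (dualResolvent φ b z - φ 1) (z * φ b)
      have h2 := norm_sub_le (dualResolvent φ b z) (φ 1)
      have h3 := norm_dualResolvent_le (hn z) φ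
      rw [norm_mul, Complex.norm_real] at h1
      rw [Complex.norm_real] at h2
      linarith
    rw [← mul_le_mul_iff_right₀ (pow_pos hz 2)]
    refine hle.trans_eq ?_
    field_simp
    ring
  have h0 := (differentiable_dualResolvent h _).apply_eq_of_tendsto_cocompact 0 hlim
  simpa [dualResolvent, resolventRe, resolventIm, quad, L, pow_two] using h0

theorem eq_zero_of_norm_inverse_quad_le {b : A} (h : ∀ z, IsUnit (quad b z))
    (hn : ∀ z, ‖Ring.inverse (quad b z)‖ ≤ 1) : b = 0 := by
  have hb := sq_eq_zero_of_norm_inverse_quad_le h hn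
  have hinv : ∀ x : ℝ, Ring.inverse (quad b x) = 1 + (2 * x) • b := by
    intro x
    have : quad b x * (1 + (2 * x) • b) = 1 := by
      have hb' : b * b = 0 := by rw [← pow_two, hb]
      simp [quad, hb, hb', mul_add, sub_mul]
    have e := Ring.inverse_mul_cancel_left _ (1 + (2 * x) • b) (h x)
    rwa [this, mul_one] at e
  by_contra hb0
  have hpos : 0 < ‖b‖ := norm_pos_iff.2 hb0
  obtain ⟨n, hlt⟩ := exists_nat_gt ((1 + ‖(1 : A)‖) / ‖b‖)
  rw [div_lt_iff₀ hpos] at hlt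
  have h1 := hn ((n : ℝ) : ℂ)
  rw [hinv] at h1
  have h2 : ‖(2 * (n : ℝ)) • b‖ ≤ ‖1 + (2 * (n : ℝ)) • b‖ + ‖(1 : A)‖ := by
    simpa using norm_sub_le (1 + (2 * (n : ℝ)) • b) 1
  rw [norm_smul, Real.norm_of_nonneg (by positivity)] at h2
  have : 0 ≤ (n : ℝ) * ‖b‖ := by positivity
  linarith

end

theorem isUnit_Qop_and_norm_inverse_le {A : Type*} [NormedRing A] [NormedAlgebra ℝ A]
    {a : A} {r : ℝ}
    (h : ∀ ε : ℝ, 0 < ε →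
      pseudoSSpectrum ε a = {q : Quaternion ℝ | ‖q - (r : Quaternion ℝ)‖ ≤ Real.sqrt ε})
    {q : Quaternion ℝ} (hq : q ≠ r) :
    IsUnit (Qop a q) ∧ ‖q - (r : Quaternion ℝ)‖ ^ 2 * ‖Ring.inverse (Qop a q)‖ ≤ 1 := by
  have hpos : 0 < ‖q - (r : Quaternion ℝ)‖ := norm_pos_iff.2 (sub_ne_zero.2 hq)
  have key : ∀ ε : ℝ, 0 < ε → ε < ‖q - (r : Quaternion ℝ)‖ ^ 2 →
      IsUnit (Qop a q) ∧ ε * ‖Ring.inverse (Qop a q)‖ ≤ 1 := by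
    intro ε hε hlt
    have hmem : q ∉ pseudoSSpectrum ε a := by
      rw [h ε hε, Set.mem_ofPred_eq, not_le]
      exact (Real.sqrt_lt' hpos).2 hlt
    simp only [pseudoSSpectrum, sSpectrum, Set.mem_union, Set.mem_ofPred_eq, not_or, not_not,
      not_and, not_le] at hmem
    refine ⟨hmem.1, ?_⟩
    have := hmem.2 hmem.1
    rw [lt_div_iff₀ hε] at this
    linarith
  refine ⟨(key _ (half_pos (pow_pos hpos 2)) (half_lt_self (pow_pos hpos 2))).1, ?_⟩
  have hcont : Continuous fun ε : ℝ => ε * ‖Ring.inverse (Qop a q)‖ := by fun_prop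
  refine le_of_tendsto (hcont.continuousAt.tendsto.mono_left nhdsWithin_le_nhds)
    (Filter.mem_of_superset (Ioo_mem_nhdsLT (pow_pos hpos 2)) fun ε hε => (key ε hε.1 hε.2).2)

theorem Qop_eq_smul_quad {A : Type*} [NormedRing A] [NormedAlgebra ℝ A] (a : A) (r : ℝ) {z : ℂ}
    (hz : z ≠ 0) :
    Qop a (r + Quaternion.coeComplex z⁻¹)
      = (Complex.normSq z)⁻¹ • quad (a - r • (1 : A)) z := by
  have hm : Complex.normSq z ≠ 0 := mt Complex.normSq_eq_zero.1 hz
  have hnorm : ‖(r : Quaternion ℝ) + Quaternion.coeComplex z⁻¹‖ ^ 2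
      = r ^ 2 + 2 * r * ((Complex.normSq z)⁻¹ * z.re) + (Complex.normSq z)⁻¹ := by
    rw [pow_two, ← Quaternion.normSq_eq_norm_mul_self, Quaternion.normSq_def']
    simp only [Quaternion.re_add, Quaternion.re_coe, Quaternion.re_coeComplex, Complex.inv_re,
      Quaternion.imI_add, Quaternion.imI_coe, Quaternion.imI_coeComplex, Complex.inv_im,
      Quaternion.imJ_add, Quaternion.imJ_coe, Quaternion.imJ_coeComplex, Quaternion.imK_add,
      Quaternion.imK_coe, Quaternion.imK_coeComplex]
    field_simp
    rw [Complex.normSq_apply]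
    ring
  rw [Qop, hnorm, quad, smul_add, smul_smul, inv_mul_cancel₀ hm]
  simp only [Quaternion.re_add, Quaternion.re_coe, Quaternion.re_coeComplex, Complex.inv_re,
    div_eq_inv_mul, pow_two, mul_sub, sub_mul, smul_mul_assoc, mul_smul_comm, one_mul, mul_one]
  module

theorem eq_real_smul_one_of_pseudoSSpectrum_eq_closedBall
    {A : Type*} [NormedRing A] [NormedAlgebra ℝ A] [CompleteSpace A] [NormOneClass A]
    (a : A) (r : ℝ)
    (h : ∀ ε : ℝ, 0 < ε →
      pseudoSSpectrum ε a =
        {q : Quaternion ℝ | ‖q - (r : Quaternion ℝ)‖ ≤ Real.sqrt ε}) :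
    a = r • (1 : A) := by
  have key : ∀ z : ℂ, IsUnit (quad (a - r • (1 : A)) z) ∧
      ‖Ring.inverse (quad (a - r • (1 : A)) z)‖ ≤ 1 := by
    intro z
    rcases eq_or_ne z 0 with rfl | hz
    · simp [quad]
    have hm : Complex.normSq z ≠ 0 := mt Complex.normSq_eq_zero.1 hz
    have hq : (r : Quaternion ℝ) + Quaternion.coeComplex z⁻¹ ≠ r := by
      intro hc
      have h0 : Quaternion.coeComplex z⁻¹ = 0 := by simpa using hc
      refine inv_ne_zero hz (Complex.ext ?_ ?_)
      · exact congrArg (fun q : Quaternion ℝ => q.re) h0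
      · exact congrArg (fun q : Quaternion ℝ => q.imI) h0
    obtain ⟨hu, hle⟩ := isUnit_Qop_and_norm_inverse_le h hq
    have hquad : quad (a - r • (1 : A)) z
        = Complex.normSq z • Qop a (r + Quaternion.coeComplex z⁻¹) := by
      rw [Qop_eq_smul_quad a r hz, smul_inv_smul₀ hm]
    have hd : ‖(r : Quaternion ℝ) + Quaternion.coeComplex z⁻¹ - r‖ ^ 2
        = (Complex.normSq z)⁻¹ := by
      rw [add_sub_cancel_left, pow_two, ← Quaternion.normSq_eq_norm_mul_self,
        Quaternion.normSq_def', ← Complex.normSq_inv, Complex.normSq_apply]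
      simp only [Quaternion.re_coeComplex, Quaternion.imI_coeComplex, Quaternion.imJ_coeComplex,
        Quaternion.imK_coeComplex]
      ring
    rw [hd] at hle
    rw [hquad]
    obtain ⟨u, hu⟩ := hu
    rw [← hu] at hle ⊢
    let v : Aˣ := Units.mk0 _ hm • u
    have hv : (v : A) = Complex.normSq z • (u : A) := rfl
    have hvi : ((v⁻¹ : Aˣ) : A) = (Complex.normSq z)⁻¹ • ((u⁻¹ : Aˣ) : A) := by
      simp [v, Units.smul_def]
    rw [← hv, Ring.inverse_unit, hvi, norm_smul, norm_inv,
      Real.norm_of_nonneg (Complex.normSq_nonneg z)]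
    exact ⟨v.isUnit, by simpa using hle⟩
  exact sub_eq_zero.1
    (eq_zero_of_norm_inverse_quad_le (fun z => (key z).1) fun z => (key z).2)
end
end
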